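/- For a symmetric invertible matrix C ∈ M_n(ℂ) and subsets J = {j₁,…,j_p}, K = {k₁,…,k_p} of {1,…,n}, the Grassmann Gaussian correlation ∫ ψ_{j₁}∧⋯∧ψ_{j_p}∧ψ̄_{k₁}∧⋯∧ψ̄_{k_p} dμ_C(Ψ̄,Ψ) equals (up to the stated sign convention) det C_{J×K}, and vanishes whenever the numbers of ψ and ψ̄ factors differ. -/

import Mathlib

open Matrix

namespace GrassmannStmt19

/-- A Grassmann algebra element on `N` generators, represented by its coefficients
in the monomial basis indexed by subsets (indices in increasing order). -/
abbrev GElt (N : ℕ) := Finset (Fin N) → ℂ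

/-- Sign for merging the ordered monomial on `T` with the one on `U`. -/
def mergeSign {N : ℕ} (T U : Finset (Fin N)) : ℂ :=
  (-1 : ℂ) ^ (∑ a ∈ T, (U.filter (fun b => b < a)).card)

/-- Grassmann (wedge) multiplication in the coefficient representation. -/
noncomputable def gMul {N : ℕ} (f g : GElt N) : GElt N :=
  fun S => ∑ T ∈ S.powerset, mergeSign T (S \ T) * f T * g (S \ T)

/-- The unit of the Grassmann algebra. -/
def gOne {N : ℕ} : GElt N := fun S => if S = ∅ then 1 else 0

noncomputable def gPow {N : ℕ} (f : GElt N) : ℕ → GElt N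
  | 0 => gOne
  | k + 1 => gMul f (gPow f k)

/-- Exponential of a Grassmann element (a finite sum, by nilpotency). -/
noncomputable def gExp {N : ℕ} (f : GElt N) : GElt N :=
  fun S => ∑ k ∈ Finset.range (N + 1), (k.factorial : ℂ)⁻¹ * gPow f k S

/-- The generator `ψ_a`. -/
def gGen {N : ℕ} (a : Fin N) : GElt N := fun S => if S = {a} then 1 else 0

/-- Wedge product of a list of generators. -/
noncomputable def gListProd {N : ℕ} (l : List (Fin N)) : GElt N :=
  (l.map gGen).foldr gMul gOne

/-- The two-form `ψ_a ∧ ψ_b`. -/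
def pairElt {N : ℕ} (a b : Fin N) : GElt N :=
  fun S => if a = b then 0 else if S = {a, b} then (if a < b then 1 else -1) else 0

/-- Among `2n` generators, `ψ_i` is generator `i` (for `i < n`)... -/
def psiIdx (n : ℕ) (i : Fin n) : Fin (2 * n) := Fin.cast (two_mul n).symm (Fin.castAdd n i)

/-- ... and `ψ̄_i` is generator `n + i`. -/
def psiBarIdx (n : ℕ) (i : Fin n) : Fin (2 * n) := Fin.cast (two_mul n).symm (Fin.natAdd n i)

/-- The quadratic form `⟨Ψ̄, M Ψ⟩ = ∑_{i,j} M_{ij} ψ̄_i ∧ ψ_j`. -/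
noncomputable def quadForm (n : ℕ) (M : Matrix (Fin n) (Fin n) ℂ) : GElt (2 * n) :=
  fun S => ∑ i, ∑ j, M i j * pairElt (psiBarIdx n i) (psiIdx n j) S

/-- The Grassmann Gaussian integral with covariance `C`:
`∫ f dμ_C = det C · [coefficient of the top form in f ∧ e^{-⟨Ψ̄, C⁻¹Ψ⟩}]`. -/
noncomputable def gaussInt (n : ℕ) (C : Matrix (Fin n) (Fin n) ℂ) (f : GElt (2 * n)) : ℂ :=
  C.det * gMul f (gExp (fun S => -(quadForm n C⁻¹ S))) Finset.univ

/-- The monomial `ψ_{j₁} ∧ ⋯ ∧ ψ_{j_p} ∧ ψ̄_{k₁} ∧ ⋯ ∧ ψ̄_{k_q}`. -/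
noncomputable def monom (n p q : ℕ) (jv : Fin p → Fin n) (kv : Fin q → Fin n) :
    GElt (2 * n) :=
  gListProd (List.ofFn (fun i => psiIdx n (jv i)) ++ List.ofFn (fun i => psiBarIdx n (kv i)))

theorem psi_inj (n : ℕ) (i j : Fin n) : psiIdx n i = psiIdx n j ↔ i = j := by
  simp [psiIdx, Fin.ext_iff]

theorem bar_inj (n : ℕ) (i j : Fin n) : psiBarIdx n i = psiBarIdx n j ↔ i = j := by
  simp [psiBarIdx, Fin.ext_iff]

theorem psi_lt_bar (n : ℕ) (i j : Fin n) : psiIdx n i < psiBarIdx n j := by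
  simp [psiIdx, psiBarIdx, Fin.lt_def]; omega

theorem psi_lt_psi (n : ℕ) (i j : Fin n) : psiIdx n i < psiIdx n j ↔ i < j := by
  rw [Fin.lt_def, Fin.lt_def]; simp [psiIdx]

theorem bar_lt_bar (n : ℕ) (i j : Fin n) : psiBarIdx n i < psiBarIdx n j ↔ i < j := by
  rw [Fin.lt_def, Fin.lt_def]; simp [psiBarIdx]

theorem psi_ne_bar (n : ℕ) (i j : Fin n) : psiIdx n i ≠ psiBarIdx n j :=
  (psi_lt_bar n i j).ne

theorem psi_or_bar (n : ℕ) (x : Fin (2 * n)) :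
    (∃ i, x = psiIdx n i) ∨ ∃ i, x = psiBarIdx n i := by
  rcases lt_or_ge x.val n with h | h
  · exact Or.inl ⟨⟨x, h⟩, by simp [psiIdx, Fin.ext_iff]⟩
  · exact Or.inr ⟨⟨x - n, by omega⟩, by simp [psiBarIdx, Fin.ext_iff]; omega⟩

/-- Indices of `ψ` factors in `S`. -/
def psiPart (n : ℕ) (S : Finset (Fin (2 * n))) : Finset (Fin n) :=
  Finset.univ.filter (fun i => psiIdx n i ∈ S)

/-- Indices of `ψ̄` factors in `S`. -/
def barPart (n : ℕ) (S : Finset (Fin (2 * n))) : Finset (Fin n) :=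
  Finset.univ.filter (fun i => psiBarIdx n i ∈ S)

/-- The set with `ψ̄` indices `a` and `ψ` indices `b`. -/
def SS (n : ℕ) {k l : ℕ} (a : Fin k → Fin n) (b : Fin l → Fin n) : Finset (Fin (2 * n)) :=
  Finset.univ.image (fun t => psiIdx n (b t)) ∪ Finset.univ.image (fun t => psiBarIdx n (a t))

theorem psi_mem_SS (n : ℕ) {k l : ℕ} (a : Fin k → Fin n) (b : Fin l → Fin n) (j : Fin n) :
    psiIdx n j ∈ SS n a b ↔ ∃ t, b t = j := by
  simp [SS, psi_inj, (psi_ne_bar n _ _).symm]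

theorem bar_mem_SS (n : ℕ) {k l : ℕ} (a : Fin k → Fin n) (b : Fin l → Fin n) (j : Fin n) :
    psiBarIdx n j ∈ SS n a b ↔ ∃ t, a t = j := by
  simp [SS, bar_inj, psi_ne_bar n _ _]

theorem psiPart_SS (n : ℕ) {k l : ℕ} (a : Fin k → Fin n) (b : Fin l → Fin n) :
    psiPart n (SS n a b) = Finset.univ.image b := by
  ext j; simp [psiPart, psi_mem_SS]

theorem barPart_SS (n : ℕ) {k l : ℕ} (a : Fin k → Fin n) (b : Fin l → Fin n) :
    barPart n (SS n a b) = Finset.univ.image a := by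
  ext j; simp [barPart, bar_mem_SS]

theorem psiPart_compl (n : ℕ) (S : Finset (Fin (2 * n))) : psiPart n Sᶜ = (psiPart n S)ᶜ := by
  ext j; simp [psiPart]

theorem barPart_compl (n : ℕ) (S : Finset (Fin (2 * n))) : barPart n Sᶜ = (barPart n S)ᶜ := by
  ext j; simp [barPart]

theorem parts_ext (n : ℕ) {S T : Finset (Fin (2 * n))} (h : psiPart n S = psiPart n T)
    (h' : barPart n S = barPart n T) : S = T := by
  ext x
  rcases psi_or_bar n x with ⟨i, rfl⟩ | ⟨i, rfl⟩
  · simpa [psiPart] using Finset.ext_iff.1 h i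
  · simpa [barPart] using Finset.ext_iff.1 h' i

theorem mergeSign_pm {N : ℕ} (T U : Finset (Fin N)) : mergeSign T U = 1 ∨ mergeSign T U = -1 :=
  neg_one_pow_eq_or ℂ _

theorem gMul_single {N : ℕ} (U : Finset (Fin N)) (c : ℂ) (g : GElt N) (S : Finset (Fin N)) :
    gMul (fun T => if T = U then c else 0) g S =
      if U ⊆ S then mergeSign U (S \ U) * c * g (S \ U) else 0 := by
  unfold gMul
  simp only [mul_ite, ite_mul, mul_zero, zero_mul]
  rw [Finset.sum_ite_eq']
  simp

theorem listProd_eq {N : ℕ} (l : List (Fin N)) (hl : l.Nodup) :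
    ∃ ε : ℂ, (ε = 1 ∨ ε = -1) ∧ gListProd l = fun S => if S = l.toFinset then ε else 0 := by
  induction l with
  | nil => exact ⟨1, Or.inl rfl, by
    funext S
    by_cases hS : S = ∅ <;> simp [gListProd, gOne, hS]⟩
  | cons a l ih =>
    rw [List.nodup_cons] at hl
    obtain ⟨ε, hε, h⟩ := ih hl.2
    refine ⟨mergeSign {a} l.toFinset * ε, ?_, ?_⟩
    · rcases hε with rfl | rfl <;> rcases mergeSign_pm {a} l.toFinset with h | h <;> simp [h]
    · funext S
      have h1 : gListProd (a :: l) S = gMul (gGen a) (gListProd l) S := rfl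
      rw [h1, h]
      unfold gGen
      rw [gMul_single]
      have ha : a ∉ l.toFinset := by simpa using hl.1
      by_cases hS : S = (a :: l).toFinset
      · have h2 : S \ {a} = l.toFinset := by
          rw [hS, List.toFinset_cons, Finset.sdiff_singleton_eq_erase, Finset.erase_insert ha]
        have h3 : {a} ⊆ S := by simp [hS]
        rw [if_pos h3, if_pos hS, h2]; simp
      · rw [if_neg hS]
        split_ifs with h3 h4
        · exfalso
          apply hS
          rw [List.toFinset_cons, ← h4, Finset.sdiff_singleton_eq_erase,
            Finset.insert_erase (by simpa using h3)]
        · simp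
        · rfl

theorem gaussInt_listProd (n : ℕ) (C : Matrix (Fin n) (Fin n) ℂ) (l : List (Fin (2 * n)))
    (hl : l.Nodup) : ∃ ε : ℂ, (ε = 1 ∨ ε = -1) ∧ gaussInt n C (gListProd l) =
      ε * (C.det * gExp (fun S => -(quadForm n C⁻¹ S)) l.toFinsetᶜ) := by
  obtain ⟨ε, hε, h⟩ := listProd_eq l hl
  refine ⟨mergeSign l.toFinset l.toFinsetᶜ * ε, ?_, ?_⟩
  · rcases hε with rfl | rfl <;> rcases mergeSign_pm l.toFinset l.toFinsetᶜ with h | h <;> simp [h]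
  · unfold gaussInt
    rw [h, gMul_single, if_pos (Finset.subset_univ _), ← Finset.compl_eq_univ_sdiff]
    ring

theorem negQuad_apply (n : ℕ) (M : Matrix (Fin n) (Fin n) ℂ) (T : Finset (Fin (2 * n))) :
    -(quadForm n M T) = ∑ i, ∑ j, if T = {psiIdx n j, psiBarIdx n i} then M i j else 0 := by
  unfold quadForm
  rw [← Finset.sum_neg_distrib]
  refine Finset.sum_congr rfl fun i _ => ?_
  rw [← Finset.sum_neg_distrib]
  refine Finset.sum_congr rfl fun j _ => ?_
  unfold pairElt
  rw [if_neg (psi_ne_bar n j i).symm, if_neg (psi_lt_bar n j i).not_gt, Finset.pair_comm]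
  split_ifs <;> simp

theorem gMul_negQuad (n : ℕ) (M : Matrix (Fin n) (Fin n) ℂ) (g : GElt (2 * n))
    (S : Finset (Fin (2 * n))) :
    gMul (fun S => -(quadForm n M S)) g S = ∑ i, ∑ j,
      if ({psiIdx n j, psiBarIdx n i} : Finset (Fin (2 * n))) ⊆ S then
        mergeSign {psiIdx n j, psiBarIdx n i} (S \ {psiIdx n j, psiBarIdx n i}) * M i j *
          g (S \ {psiIdx n j, psiBarIdx n i}) else 0 := by
  simp only [← gMul_single]
  unfold gMul
  simp only [negQuad_apply, Finset.mul_sum, Finset.sum_mul]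
  rw [Finset.sum_comm]
  refine Finset.sum_congr rfl fun i _ => ?_
  rw [Finset.sum_comm]

theorem psiPart_sdiff (n : ℕ) (S : Finset (Fin (2 * n))) (i j : Fin n) :
    psiPart n (S \ {psiIdx n j, psiBarIdx n i}) = (psiPart n S).erase j := by
  ext x; simp [psiPart, psi_inj, psi_ne_bar, and_comm]

theorem barPart_sdiff (n : ℕ) (S : Finset (Fin (2 * n))) (i j : Fin n) :
    barPart n (S \ {psiIdx n j, psiBarIdx n i}) = (barPart n S).erase i := by
  ext x; simp [barPart, bar_inj, (psi_ne_bar n _ _).symm, and_comm]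

theorem gPow_card (n : ℕ) (M : Matrix (Fin n) (Fin n) ℂ) (m : ℕ) (S : Finset (Fin (2 * n)))
    (h : gPow (fun S => -(quadForm n M S)) m S ≠ 0) :
    (psiPart n S).card = m ∧ (barPart n S).card = m := by
  induction m generalizing S with
  | zero =>
    have : S = ∅ := by
      by_contra hS
      exact h (by simp [gPow, gOne, hS])
    subst this
    simp [psiPart, barPart]
  | succ m ih =>
    rw [gPow, gMul_negQuad] at h
    obtain ⟨i, -, hi⟩ := Finset.exists_ne_zero_of_sum_ne_zero h
    obtain ⟨j, -, hj⟩ := Finset.exists_ne_zero_of_sum_ne_zero hi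
    split_ifs at hj with hs
    · have := ih _ (right_ne_zero_of_mul hj)
      rw [psiPart_sdiff, barPart_sdiff, Finset.card_erase_of_mem, Finset.card_erase_of_mem] at this
      · have h1 : 0 < (psiPart n S).card := Finset.card_pos.2 ⟨j, by
          simpa [psiPart] using hs (by simp)⟩
        have h2 : 0 < (barPart n S).card := Finset.card_pos.2 ⟨i, by
          simpa [barPart] using hs (by simp)⟩
        omega
      · simpa [barPart] using hs (by simp)
      · simpa [psiPart] using hs (by simp)
    · exact absurd rfl hj

theorem gExp_zero (n : ℕ) (M : Matrix (Fin n) (Fin n) ℂ) (S : Finset (Fin (2 * n)))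
    (h : (psiPart n S).card ≠ (barPart n S).card) :
    gExp (fun S => -(quadForm n M S)) S = 0 := by
  unfold gExp
  refine Finset.sum_eq_zero fun k _ => ?_
  by_contra hk
  have := gPow_card n M k S (right_ne_zero_of_mul hk)
  omega

theorem SS_sdiff (n : ℕ) {k : ℕ} (a b : Fin (k + 1) → Fin n) (ha : StrictMono a)
    (hb : StrictMono b) (r c : Fin (k + 1)) :
    SS n a b \ {psiIdx n (b c), psiBarIdx n (a r)} = SS n (a ∘ r.succAbove) (b ∘ c.succAbove) := by
  apply parts_ext
  · rw [psiPart_sdiff, psiPart_SS, psiPart_SS]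
    ext x
    simp only [Finset.mem_erase, Finset.mem_image, Finset.mem_univ, true_and, Function.comp]
    constructor
    · rintro ⟨hx, t, rfl⟩
      obtain ⟨s, rfl⟩ := Fin.exists_succAbove_eq (x := t) (y := c) (fun h => hx (by rw [h]))
      exact ⟨s, rfl⟩
    · rintro ⟨t, rfl⟩
      exact ⟨fun h => Fin.succAbove_ne c t (hb.injective h), _, rfl⟩
  · rw [barPart_sdiff, barPart_SS, barPart_SS]
    ext x
    simp only [Finset.mem_erase, Finset.mem_image, Finset.mem_univ, true_and, Function.comp]
    constructor
    · rintro ⟨hx, t, rfl⟩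
      obtain ⟨s, rfl⟩ := Fin.exists_succAbove_eq (x := t) (y := r) (fun h => hx (by rw [h]))
      exact ⟨s, rfl⟩
    · rintro ⟨t, rfl⟩
      exact ⟨fun h => Fin.succAbove_ne r t (ha.injective h), _, rfl⟩

theorem card_filter_SS (n : ℕ) {k l : ℕ} (a : Fin k → Fin n) (b : Fin l → Fin n)
    (ha : StrictMono a) (hb : StrictMono b) (P : Fin (2 * n) → Prop) [DecidablePred P] :
    ((SS n a b).filter P).card = (Finset.univ.filter fun t => P (psiIdx n (b t))).card +
      (Finset.univ.filter fun t => P (psiBarIdx n (a t))).card := by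
  unfold SS
  rw [Finset.filter_union, Finset.card_union_of_disjoint, Finset.filter_image,
    Finset.filter_image, Finset.card_image_of_injective, Finset.card_image_of_injective]
  · exact fun x y h => ha.injective ((bar_inj n _ _).1 h)
  · exact fun x y h => hb.injective ((psi_inj n _ _).1 h)
  · apply Finset.disjoint_filter_filter
    rw [Finset.disjoint_left]
    intro x hx hx'
    simp only [Finset.mem_image, Finset.mem_univ, true_and] at hx hx'
    obtain ⟨i, rfl⟩ := hx
    obtain ⟨j, hj⟩ := hx'
    exact psi_ne_bar n _ _ hj.symm

theorem card_succAbove_lt {k : ℕ} (c : Fin (k + 1)) :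
    (Finset.univ.filter fun t : Fin k => c.succAbove t < c).card = c := by
  have h : ∀ t : Fin k, c.succAbove t < c ↔ (t : ℕ) < c := by
    intro t
    rw [Fin.succAbove_lt_iff_castSucc_lt, Fin.lt_def, Fin.val_castSucc]
  simp only [h]
  rw [Fin.card_filter_val_lt]
  omega

theorem mergeSign_SS (n : ℕ) {k : ℕ} (a b : Fin (k + 1) → Fin n) (ha : StrictMono a)
    (hb : StrictMono b) (r c : Fin (k + 1)) :
    mergeSign {psiIdx n (b c), psiBarIdx n (a r)} (SS n (a ∘ r.succAbove) (b ∘ c.succAbove))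
      = (-1) ^ k * (-1) ^ ((r : ℕ) + c) := by
  have ha' := ha.comp (Fin.strictMono_succAbove r)
  have hb' := hb.comp (Fin.strictMono_succAbove c)
  unfold mergeSign
  rw [Finset.sum_pair (psi_ne_bar n _ _), card_filter_SS n _ _ ha' hb',
    card_filter_SS n _ _ ha' hb']
  simp only [Function.comp, psi_lt_psi, bar_lt_bar, psi_lt_bar, (psi_lt_bar n _ _).not_gt,
    ha.lt_iff_lt, hb.lt_iff_lt, card_succAbove_lt]
  simp only [Finset.filter_true, Finset.filter_false, Finset.card_empty, Finset.card_univ,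
    Fintype.card_fin]
  ring

theorem sum_ite_range (n : ℕ) {k : ℕ} (a : Fin k → Fin n) (ha : StrictMono a) (F : Fin n → ℂ) :
    (∑ i, if ∃ t, a t = i then F i else 0) = ∑ t, F (a t) := by
  classical
  rw [← Finset.sum_filter, ← Finset.sum_image (s := Finset.univ) (g := a) (f := F)
    (ha.injective.injOn)]
  refine Finset.sum_congr ?_ fun _ _ => rfl
  ext x; simp

theorem gPow_SS (n : ℕ) (M : Matrix (Fin n) (Fin n) ℂ) (k : ℕ) :
    ∃ δ : ℂ, (δ = 1 ∨ δ = -1) ∧ ∀ (a b : Fin k → Fin n), StrictMono a → StrictMono b →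
      gPow (fun S => -(quadForm n M S)) k (SS n a b)
        = δ * k.factorial * (M.submatrix a b).det := by
  induction k with
  | zero =>
    refine ⟨1, Or.inl rfl, fun a b _ _ => ?_⟩
    simp [gPow, gOne, SS]
  | succ k ih =>
    obtain ⟨δ, hδ, ih⟩ := ih
    refine ⟨(-1) ^ k * δ, ?_, fun a b ha hb => ?_⟩
    · rcases hδ with rfl | rfl <;> rcases neg_one_pow_eq_or ℂ k with h | h <;> simp [h]
    · rw [gPow, gMul_negQuad]
      have hsub : ∀ i j, (({psiIdx n j, psiBarIdx n i} : Finset (Fin (2 * n))) ⊆ SS n a b) ↔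
          ((∃ t, a t = i) ∧ ∃ t, b t = j) := by
        intro i j
        rw [Finset.insert_subset_iff, Finset.singleton_subset_iff, psi_mem_SS, bar_mem_SS, and_comm]
      simp only [hsub, ite_and, Finset.sum_ite_irrel, Finset.sum_const_zero]
      rw [sum_ite_range n a ha]
      have hrow : ∀ r : Fin (k + 1), (∑ j, if ∃ t, b t = j then
          mergeSign {psiIdx n j, psiBarIdx n (a r)} (SS n a b \ {psiIdx n j, psiBarIdx n (a r)})
            * M (a r) j * gPow (fun S => -(quadForm n M S)) k
              (SS n a b \ {psiIdx n j, psiBarIdx n (a r)}) else 0)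
          = (-1) ^ k * δ * k.factorial * (M.submatrix a b).det := by
        intro r
        rw [sum_ite_range n b hb, Matrix.det_succ_row _ r, Finset.mul_sum]
        refine Finset.sum_congr rfl fun c _ => ?_
        rw [SS_sdiff n a b ha hb, mergeSign_SS n a b ha hb,
          ih _ _ (ha.comp (Fin.strictMono_succAbove r)) (hb.comp (Fin.strictMono_succAbove c)),
          Matrix.submatrix_submatrix, Matrix.submatrix_apply]
        ring
      rw [Finset.sum_congr rfl fun r _ => hrow r]
      simp only [Finset.sum_const, Finset.card_univ, Fintype.card_fin, nsmul_eq_mul,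
        Nat.factorial_succ]
      push_cast
      ring

theorem gExp_SS (n : ℕ) (M : Matrix (Fin n) (Fin n) ℂ) (k : ℕ) (a b : Fin k → Fin n)
    (ha : StrictMono a) (hb : StrictMono b) (hk : k ≤ n) :
    ∃ δ : ℂ, (δ = 1 ∨ δ = -1) ∧
      gExp (fun S => -(quadForm n M S)) (SS n a b) = δ * (M.submatrix a b).det := by
  obtain ⟨δ, hδ, h⟩ := gPow_SS n M k
  refine ⟨δ, hδ, ?_⟩
  unfold gExp
  rw [Finset.sum_eq_single k]
  · rw [h a b ha hb]
    have : (k.factorial : ℂ) ≠ 0 := by exact_mod_cast k.factorial_ne_zero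
    field_simp
  · intro m _ hm
    by_contra hne
    have := (gPow_card n M m _ (right_ne_zero_of_mul hne)).1
    rw [psiPart_SS, Finset.card_image_of_injective _ hb.injective] at this
    simp at this
    omega
  · intro hk'
    simp at hk'
    omega

theorem det_submatrix_pm {ι κ : Type*} [Fintype ι] [DecidableEq ι] [Fintype κ] [DecidableEq κ]
    (C : Matrix ι ι ℂ) (e f : κ ≃ ι) : ∃ γ : ℂ, (γ = 1 ∨ γ = -1) ∧
      (C.submatrix e f).det = γ * C.det := by
  refine ⟨((Equiv.Perm.sign (f.symm.trans e) : ℤ) : ℂ), ?_, ?_⟩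
  · rcases Int.units_eq_one_or (Equiv.Perm.sign (f.symm.trans e)) with h | h <;> simp [h]
  · rw [← Matrix.det_permute, ← Matrix.det_submatrix_equiv_self f]
    congr 1
    ext i j
    simp

theorem jacobi (n m p : ℕ) (hmp : m + p = n) (C : Matrix (Fin n) (Fin n) ℂ)
    (hinv : IsUnit C.det) (a b : Fin m → Fin n) (jv kv : Fin p → Fin n)
    (ha : Function.Injective a) (hb : Function.Injective b)
    (hj : Function.Injective jv) (hk : Function.Injective kv)
    (hbj : ∀ i j, b i ≠ jv j) (hak : ∀ i j, a i ≠ kv j) :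
    ∃ γ : ℂ, (γ = 1 ∨ γ = -1) ∧
      C.det * (C⁻¹.submatrix a b).det = γ * (C.submatrix jv kv).det := by
  have hcard : Fintype.card (Fin m ⊕ Fin p) = Fintype.card (Fin n) := by simp [hmp]
  let e1 : Fin m ⊕ Fin p ≃ Fin n := Equiv.ofBijective (Sum.elim b jv)
    ((Fintype.bijective_iff_injective_and_card _).2 ⟨hb.sumElim hj hbj, hcard⟩)
  let e2 : Fin m ⊕ Fin p ≃ Fin n := Equiv.ofBijective (Sum.elim a kv)
    ((Fintype.bijective_iff_injective_and_card _).2 ⟨ha.sumElim hk hak, hcard⟩)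
  obtain ⟨γ, hγ, hdet⟩ := det_submatrix_pm C e1 e2
  refine ⟨γ, hγ, ?_⟩
  have hmul : C.submatrix e1 e2 * C⁻¹.submatrix e2 e1 = 1 := by
    rw [Matrix.submatrix_mul_equiv, Matrix.mul_nonsing_inv _ hinv, Matrix.submatrix_one_equiv]
  have hCb : C.submatrix e1 e2 = Matrix.fromBlocks (C.submatrix b a) (C.submatrix b kv)
      (C.submatrix jv a) (C.submatrix jv kv) := by
    ext i j; rcases i with i | i <;> rcases j with j | j <;> rfl
  have hMb : C⁻¹.submatrix e2 e1 = Matrix.fromBlocks (C⁻¹.submatrix a b) (C⁻¹.submatrix a jv)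
      (C⁻¹.submatrix kv b) (C⁻¹.submatrix kv jv) := by
    ext i j; rcases i with i | i <;> rcases j with j | j <;> rfl
  rw [hCb, hMb, Matrix.fromBlocks_multiply, ← Matrix.fromBlocks_one, Matrix.fromBlocks_inj] at hmul
  obtain ⟨h11, -, h21, -⟩ := hmul
  have key : C.submatrix e1 e2 * Matrix.fromBlocks (C⁻¹.submatrix a b) 0 (C⁻¹.submatrix kv b) 1
      = Matrix.fromBlocks 1 (C.submatrix b kv) 0 (C.submatrix jv kv) := by
    rw [hCb, Matrix.fromBlocks_multiply, h11, h21]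
    simp
  have := congrArg Matrix.det key
  rw [Matrix.det_mul, Matrix.det_fromBlocks_zero₁₂, Matrix.det_fromBlocks_zero₂₁, hdet,
    Matrix.det_one, Matrix.det_one, one_mul, mul_one] at this
  rw [← this]
  rcases hγ with rfl | rfl <;> ring

/-- Grassmann Gaussian correlations: the mixed correlation vanishes when the numbers of
`ψ` and `ψ̄` factors differ, and otherwise equals (up to the sign convention of the
Berezin integration order) the minor `det C_{J×K}`. -/
theorem grassmann_gaussian_correlation (n p q : ℕ) (C : Matrix (Fin n) (Fin n) ℂ)
    (hC : Cᵀ = C) (hinv : IsUnit C.det)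
    (jv : Fin p → Fin n) (kv : Fin q → Fin n)
    (hjv : StrictMono jv) (hkv : StrictMono kv) (hp : 0 < p) (hq : 0 < q) :
    (p ≠ q → gaussInt n C (monom n p q jv kv) = 0)
    ∧ (∀ h : p = q, ∃ ε : ℂ, (ε = 1 ∨ ε = -1) ∧
        gaussInt n C (monom n p q jv kv)
          = ε * (C.submatrix jv (kv ∘ Fin.cast h)).det) := by
  have hl : (List.ofFn (fun i => psiIdx n (jv i)) ++ List.ofFn (fun i => psiBarIdx n (kv i))).Nodup := by
    rw [List.nodup_append]
    refine ⟨List.nodup_ofFn.2 ?_, List.nodup_ofFn.2 ?_, ?_⟩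
    · exact fun x y h => hjv.injective ((psi_inj n _ _).1 h)
    · exact fun x y h => hkv.injective ((bar_inj n _ _).1 h)
    · intro x hx y hy
      rw [List.mem_ofFn] at hx hy
      obtain ⟨i, rfl⟩ := hx
      obtain ⟨j, rfl⟩ := hy
      exact psi_ne_bar n _ _
  have hU : (List.ofFn (fun i => psiIdx n (jv i)) ++ List.ofFn (fun i => psiBarIdx n (kv i))).toFinset
      = SS n kv jv := by
    ext x
    simp [SS, List.mem_ofFn]
  obtain ⟨ε, hε, hm⟩ := gaussInt_listProd n C _ hl
  rw [hU] at hm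
  have hm' : gaussInt n C (monom n p q jv kv) = ε * (C.det *
      gExp (fun S => -(quadForm n C⁻¹ S)) (SS n kv jv)ᶜ) := hm
  have hpc : (psiPart n (SS n kv jv)ᶜ).card = n - p := by
    rw [psiPart_compl, Finset.card_compl, psiPart_SS, Finset.card_image_of_injective _ hjv.injective]
    simp
  have hbc : (barPart n (SS n kv jv)ᶜ).card = n - q := by
    rw [barPart_compl, Finset.card_compl, barPart_SS, Finset.card_image_of_injective _ hkv.injective]
    simp
  have hpn : p ≤ n := by simpa using Fintype.card_le_of_injective _ hjv.injective
  have hqn : q ≤ n := by simpa using Fintype.card_le_of_injective _ hkv.injective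
  constructor
  · intro hpq
    rw [hm', gExp_zero, mul_zero, mul_zero]
    omega
  · intro h
    subst h
    set A := barPart n (SS n kv jv)ᶜ with hA
    set B := psiPart n (SS n kv jv)ᶜ with hB
    have hS : (SS n kv jv)ᶜ = SS n (A.orderEmbOfFin hbc) (B.orderEmbOfFin hpc) := by
      apply parts_ext
      · rw [psiPart_SS, ← hB, Finset.image_orderEmbOfFin_univ]
      · rw [barPart_SS, ← hA, Finset.image_orderEmbOfFin_univ]
    obtain ⟨δ, hδ, hg⟩ := gExp_SS n C⁻¹ (n - p) (A.orderEmbOfFin hbc) (B.orderEmbOfFin hpc)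
      (A.orderEmbOfFin hbc).strictMono (B.orderEmbOfFin hpc).strictMono (by omega)
    obtain ⟨γ, hγ, hj⟩ := jacobi n (n - p) p (by omega) C hinv (A.orderEmbOfFin hbc)
      (B.orderEmbOfFin hpc) jv kv (A.orderEmbOfFin hbc).injective (B.orderEmbOfFin hpc).injective
      hjv.injective hkv.injective
      (by
        intro i j hij
        have := B.orderEmbOfFin_mem hpc i
        rw [hij, hB, psiPart_compl, psiPart_SS] at this
        simp at this)
      (by
        intro i j hij
        have := A.orderEmbOfFin_mem hbc i
        rw [hij, hA, barPart_compl, barPart_SS] at this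
        simp at this)
    refine ⟨ε * δ * γ, ?_, ?_⟩
    · rcases hε with rfl | rfl <;> rcases hδ with rfl | rfl <;> rcases hγ with rfl | rfl <;> simp
    · rw [hm', hS, hg]
      have : C.submatrix jv (kv ∘ Fin.cast rfl) = C.submatrix jv kv := rfl
      rw [this]
      linear_combination ε * δ * hj

end GrassmannStmt19
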